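/- Under the Tikhonov EKI setup with the regularity assumption on H, there exist a constant M_3 > 0 and a threshold n_0 ∈ ℕ such that for all n ≥ n_0 the ensemble Kalman mean increment Δ_n := m_{n+1} − m_n = C_n^{up}(C_n^{pp} + h_n^{−1}Γ_+)^{−1}(z − H(m_n)) and the Gauss–Newton increment G_n := C_n^{uu} J_nᵀ (J_n C_n^{uu} J_nᵀ + h_n^{−1}Γ_+)^{−1}(z − H(m_n)), with J_n = ∇H(m_n), satisfy ‖G_n − Δ_n‖ ≤ M_3 h_n K ‖C_n^{uu}‖^{3/2} ‖z − H(m_n)‖. -/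

import Mathlib

open scoped BigOperators
open Matrix

noncomputable section

/-- Euclidean norm of a vector `v : Fin d → ℝ`. -/
def evNorm {d : ℕ} (v : Fin d → ℝ) : ℝ := Real.sqrt (∑ i, v i ^ 2)

/-- Spectral (ℓ²-operator) norm of a real matrix. -/
def spNorm {p q : ℕ} (A : Matrix (Fin p) (Fin q) ℝ) : ℝ :=
  sSup {r : ℝ | ∃ v : Fin q → ℝ, evNorm v ≤ 1 ∧ r = evNorm (A.mulVec v)}

/-- Smallest eigenvalue (Rayleigh quotient infimum) of a square matrix. -/
def lambdaMin {d : ℕ} (A : Matrix (Fin d) (Fin d) ℝ) : ℝ :=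
  sInf {r : ℝ | ∃ v : Fin d → ℝ, evNorm v = 1 ∧ r = v ⬝ᵥ A.mulVec v}

/-- Loewner order `A ⪯ B` : `B - A` is positive semidefinite. -/
def loewnerLE {d : ℕ} (A B : Matrix (Fin d) (Fin d) ℝ) : Prop := (B - A).PosSemidef

/-- Sample mean of an ensemble of `K` vectors. -/
def sMean {K d : ℕ} (u : Fin K → Fin d → ℝ) : Fin d → ℝ := (K : ℝ)⁻¹ • ∑ i, u i

/-- Sample (cross-)covariance of two ensembles. -/
def sCov {K p q : ℕ} (a : Fin K → Fin p → ℝ) (b : Fin K → Fin q → ℝ) :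
    Matrix (Fin p) (Fin q) ℝ :=
  (K : ℝ)⁻¹ • ∑ i, Matrix.of (fun j l => (a i j - sMean a j) * (b i l - sMean b l))

/-- Jacobian matrix of a map between finite-dimensional coordinate spaces. -/
def jac {a b : ℕ} (H : (Fin a → ℝ) → Fin b → ℝ) (x : Fin a → ℝ) :
    Matrix (Fin b) (Fin a) ℝ :=
  Matrix.of fun i j => fderiv ℝ H x (Pi.single j 1) i

/-- Gradient (coordinate) vector of a scalar function. -/
def gradVec {d : ℕ} (f : (Fin d → ℝ) → ℝ) (x : Fin d → ℝ) : Fin d → ℝ :=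
  fun j => fderiv ℝ f x (Pi.single j 1)

/-- The augmented (Tikhonov) observation map `u ↦ (G u, u)`. -/
def aug {du dy : ℕ} (G : (Fin du → ℝ) → Fin dy → ℝ) (u : Fin du → ℝ) :
    Fin (dy + du) → ℝ :=
  Fin.append (G u) u

/-- The augmented noise covariance `Γ₊ = blockdiag(Γ, I)`. -/
def gammaPlus {dy du : ℕ} (Γ : Matrix (Fin dy) (Fin dy) ℝ) :
    Matrix (Fin (dy + du)) (Fin (dy + du)) ℝ :=
  Matrix.reindex finSumFinEquiv finSumFinEquiv (Matrix.fromBlocks Γ 0 0 1)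

/-- `C^{uu}`: sample covariance of the ensemble. -/
def Cuu {K du : ℕ} (u : Fin K → Fin du → ℝ) : Matrix (Fin du) (Fin du) ℝ := sCov u u

/-- `C^{up}`: sample cross-covariance of the ensemble and its (augmented) observations. -/
def Cup {K du dy : ℕ} (G : (Fin du → ℝ) → Fin dy → ℝ) (u : Fin K → Fin du → ℝ) :
    Matrix (Fin du) (Fin (dy + du)) ℝ :=
  sCov u (fun i => aug G (u i))

/-- `C^{pp}`: sample covariance of the (augmented) observations. -/
def Cpp {K du dy : ℕ} (G : (Fin du → ℝ) → Fin dy → ℝ) (u : Fin K → Fin du → ℝ) :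
    Matrix (Fin (dy + du)) (Fin (dy + du)) ℝ :=
  sCov (fun i => aug G (u i)) (fun i => aug G (u i))


lemma evNorm_eq {d : ℕ} (v : Fin d → ℝ) : evNorm v = ‖WithLp.toLp 2 v‖ := by
  simp [evNorm, EuclideanSpace.norm_eq]

lemma evNorm_nonneg' {d : ℕ} (v : Fin d → ℝ) : 0 ≤ evNorm v := Real.sqrt_nonneg _

lemma evNorm_add_le' {d : ℕ} (v w : Fin d → ℝ) : evNorm (v + w) ≤ evNorm v + evNorm w := by
  simp only [evNorm_eq, WithLp.toLp_add]; exact norm_add_le _ _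

lemma evNorm_sub_le' {d : ℕ} (v w : Fin d → ℝ) : evNorm (v - w) ≤ evNorm v + evNorm w := by
  simp only [evNorm_eq, WithLp.toLp_sub]; exact norm_sub_le _ _

lemma evNorm_smul' {d : ℕ} (c : ℝ) (v : Fin d → ℝ) : evNorm (c • v) = |c| * evNorm v := by
  simp only [evNorm_eq, WithLp.toLp_smul, norm_smul, Real.norm_eq_abs]

lemma evNorm_sum_le' {d : ℕ} {ι : Type*} (s : Finset ι) (f : ι → Fin d → ℝ) :
    evNorm (∑ i ∈ s, f i) ≤ ∑ i ∈ s, evNorm (f i) := by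
  simp only [evNorm_eq, WithLp.toLp_sum]; exact norm_sum_le _ _

lemma evNorm_zero' {d : ℕ} : evNorm (0 : Fin d → ℝ) = 0 := by simp [evNorm]

lemma evNorm_sq' {d : ℕ} (v : Fin d → ℝ) : v ⬝ᵥ v = evNorm v ^ 2 := by
  rw [evNorm, Real.sq_sqrt (Finset.sum_nonneg fun i _ => sq_nonneg _)]
  simp [dotProduct, sq]

lemma evNorm_pos' {d : ℕ} {v : Fin d → ℝ} (h : v ≠ 0) : 0 < evNorm v := by
  rw [evNorm_eq]; simpa using h

lemma abs_dot_le {d : ℕ} (v w : Fin d → ℝ) : |v ⬝ᵥ w| ≤ evNorm v * evNorm w := by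
  have h := abs_real_inner_le_norm (WithLp.toLp 2 w) (WithLp.toLp 2 v)
  rw [evNorm_eq, evNorm_eq, mul_comm]
  simpa [EuclideanSpace.inner_eq_star_dotProduct] using h

/-- Averages of vectors bounded by `c` are bounded by `c`. -/
lemma evNorm_avg_le {K d : ℕ} (f : Fin K → Fin d → ℝ) (c : ℝ) (hc : 0 ≤ c)
    (h : ∀ i, evNorm (f i) ≤ c) : evNorm ((K : ℝ)⁻¹ • ∑ i, f i) ≤ c := by
  rw [evNorm_smul', abs_of_nonneg (by positivity)]
  have h1 : evNorm (∑ i, f i) ≤ K * c := by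
    refine (evNorm_sum_le' _ _).trans ?_
    refine (Finset.sum_le_sum fun i _ => h i).trans ?_
    simp
  rcases Nat.eq_zero_or_pos K with hK | hK
  · subst hK; simpa using hc
  · have : (0 : ℝ) < K := by exact_mod_cast hK
    calc _ ≤ (K : ℝ)⁻¹ * (K * c) := by gcongr
      _ = c := by field_simp

lemma exists_mulVec_bound {p q : ℕ} (A : Matrix (Fin p) (Fin q) ℝ) :
    ∃ L : ℝ, 0 ≤ L ∧ ∀ v, evNorm (A.mulVec v) ≤ L * evNorm v := by
  let T := (Matrix.toLpLin 2 2 A).toContinuousLinearMap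
  refine ⟨‖T‖, norm_nonneg _, fun v => ?_⟩
  have := T.le_opNorm (WithLp.toLp 2 v)
  rw [evNorm_eq, evNorm_eq]
  simpa [T] using this

lemma mulVec_le_spNorm {p q : ℕ} (A : Matrix (Fin p) (Fin q) ℝ) (v : Fin q → ℝ) :
    evNorm (A.mulVec v) ≤ spNorm A * evNorm v := by
  obtain ⟨L, hL0, hL⟩ := exists_mulVec_bound A
  by_cases hv : v = 0
  · subst hv; simp [evNorm_zero']
  have hp := evNorm_pos' hv
  have hb : BddAbove {r : ℝ | ∃ v : Fin q → ℝ, evNorm v ≤ 1 ∧ r = evNorm (A.mulVec v)} := by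
    refine ⟨L, ?_⟩
    rintro r ⟨w, hw, rfl⟩
    exact (hL w).trans (by nlinarith)
  have : evNorm (A.mulVec ((evNorm v)⁻¹ • v)) ≤ spNorm A := by
    refine le_csSup hb ⟨_, ?_, rfl⟩
    rw [evNorm_smul', abs_of_pos (by positivity)]
    field_simp; rfl
  rw [Matrix.mulVec_smul, evNorm_smul', abs_of_pos (by positivity)] at this
  field_simp at this
  linarith

lemma spNorm_nonneg' {p q : ℕ} (A : Matrix (Fin p) (Fin q) ℝ) : 0 ≤ spNorm A := by
  apply Real.sSup_nonneg
  rintro r ⟨w, hw, rfl⟩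
  exact evNorm_nonneg' _

lemma coercive_of_pos {d : ℕ} (A : Matrix (Fin d) (Fin d) ℝ)
    (h : ∀ v, v ≠ 0 → 0 < v ⬝ᵥ A.mulVec v) :
    ∃ l : ℝ, 0 < l ∧ ∀ v, l * evNorm v ^ 2 ≤ v ⬝ᵥ A.mulVec v := by
  by_cases hne : (Metric.sphere (0 : EuclideanSpace ℝ (Fin d)) 1).Nonempty
  · obtain ⟨w, hw, hmin⟩ := (isCompact_sphere (0 : EuclideanSpace ℝ (Fin d)) 1).exists_isMinOn hne
      (f := fun w => w.ofLp ⬝ᵥ A.mulVec w.ofLp) (by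
        apply Continuous.continuousOn
        simp only [dotProduct, Matrix.mulVec]
        fun_prop)
    have hw1 : ‖w‖ = 1 := by simpa using hw
    refine ⟨w.ofLp ⬝ᵥ A.mulVec w.ofLp, h _ ?_, ?_⟩
    · intro h0
      have : w = 0 := by ext i; simpa using congrFun h0 i
      simp [this] at hw1
    · intro v
      by_cases hv : v = 0
      · subst hv; simp [evNorm_zero']
      have hp := evNorm_pos' hv
      have := hmin (a := WithLp.toLp 2 ((evNorm v)⁻¹ • v)) (by
        simp only [mem_sphere_iff_norm, sub_zero]
        rw [← evNorm_eq, evNorm_smul', abs_of_pos (by positivity)]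
        field_simp)
      simp only [Set.mem_ofPred_eq, Matrix.mulVec_smul, smul_dotProduct, dotProduct_smul,
        smul_eq_mul] at this
      field_simp at this
      linarith
  · refine ⟨1, one_pos, fun v => ?_⟩
    by_cases hv : v = 0
    · subst hv; simp [evNorm_zero']
    have hp := evNorm_pos' hv
    exfalso; apply hne
    refine ⟨WithLp.toLp 2 ((evNorm v)⁻¹ • v), ?_⟩
    simp only [mem_sphere_iff_norm, sub_zero]
    rw [← evNorm_eq, evNorm_smul', abs_of_pos (by positivity)]
    field_simp

lemma inv_of_coercive {d : ℕ} (A : Matrix (Fin d) (Fin d) ℝ) (c : ℝ) (hc : 0 < c)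
    (h : ∀ v, c * evNorm v ^ 2 ≤ v ⬝ᵥ A.mulVec v) : IsUnit A := by
  rw [← Matrix.mulVec_injective_iff_isUnit]
  rw [← Matrix.coe_mulVecLin, injective_iff_map_eq_zero]
  intro v hv
  by_contra hne
  have hp := evNorm_pos' hne
  have := h v
  rw [Matrix.mulVecLin_apply] at hv
  rw [hv] at this
  simp at this
  have : 0 < c * evNorm v ^ 2 := by positivity
  linarith

lemma coercive_norm {c a b : ℝ} (hc : 0 < c) (ha : 0 ≤ a) (hb : 0 ≤ b)
    (h : c * a ^ 2 ≤ a * b) : a ≤ b / c := by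
  rw [le_div_iff₀ hc]
  rcases ha.eq_or_lt with h0 | h0
  · rw [← h0]; simpa using hb
  · nlinarith

lemma gammaPlus_pos {dy du : ℕ} (Γ : Matrix (Fin dy) (Fin dy) ℝ) (hΓ : Γ.PosDef)
    (v : Fin (dy + du) → ℝ) (hv : v ≠ 0) :
    0 < v ⬝ᵥ (gammaPlus (du := du) Γ).mulVec v := by
  have key : v ⬝ᵥ (gammaPlus (du := du) Γ).mulVec v =
      (fun i => v (Fin.castAdd du i)) ⬝ᵥ Γ.mulVec (fun i => v (Fin.castAdd du i)) +
      (fun i => v (Fin.natAdd dy i)) ⬝ᵥ (fun i => v (Fin.natAdd dy i)) := by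
    simp [gammaPlus, dotProduct, Matrix.mulVec, Fin.sum_univ_add, Matrix.one_apply]
  rw [key]
  by_cases h1 : (fun i => v (Fin.castAdd du i)) = 0
  · have h2 : (fun i => v (Fin.natAdd dy i)) ≠ 0 := by
      intro h2
      apply hv
      funext k
      refine Fin.addCases (fun i => ?_) (fun i => ?_) k
      · exact congrFun h1 i
      · exact congrFun h2 i
    rw [h1, evNorm_sq']
    have := evNorm_pos' h2
    simp; positivity
  · have := hΓ.dotProduct_mulVec_pos h1
    simp only [star_trivial] at this
    rw [evNorm_sq']
    have := sq_nonneg (evNorm (fun i => v (Fin.natAdd dy i)))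
    linarith

lemma sCov_mulVec {K p q : ℕ} (a : Fin K → Fin p → ℝ) (b : Fin K → Fin q → ℝ)
    (x : Fin q → ℝ) :
    (sCov a b).mulVec x = (K : ℝ)⁻¹ • ∑ i, ((b i - sMean b) ⬝ᵥ x) • (a i - sMean a) := by
  rw [sCov, Matrix.smul_mulVec, Matrix.sum_mulVec]
  congr 1
  refine Finset.sum_congr rfl fun i _ => ?_
  funext j
  simp only [Matrix.mulVec, dotProduct, Matrix.of_apply, Pi.smul_apply, Pi.sub_apply, smul_eq_mul,
    Finset.sum_mul]
  exact Finset.sum_congr rfl fun l _ => by ring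

lemma sCov_quad {K p : ℕ} (a : Fin K → Fin p → ℝ) (x : Fin p → ℝ) :
    x ⬝ᵥ (sCov a a).mulVec x = (K : ℝ)⁻¹ * ∑ i, ((a i - sMean a) ⬝ᵥ x) ^ 2 := by
  rw [sCov_mulVec, dotProduct_smul, dotProduct_sum, smul_eq_mul]
  congr 1
  refine Finset.sum_congr rfl fun i _ => ?_
  rw [dotProduct_smul, smul_eq_mul, dotProduct_comm x, sq]

lemma sum_dev {K p : ℕ} (a : Fin K → Fin p → ℝ) : ∑ i, (a i - sMean a) = 0 := by
  rcases Nat.eq_zero_or_pos K with hK | hK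
  · subst hK; simp
  · have : (K : ℝ) ≠ 0 := by positivity
    rw [Finset.sum_sub_distrib, Finset.sum_const, sMean, Finset.card_univ, Fintype.card_fin,
      ← Nat.cast_smul_eq_nsmul ℝ, smul_smul, mul_inv_cancel₀ this, one_smul, sub_self]

lemma dev_sq_le {K p : ℕ} (a : Fin K → Fin p → ℝ) (i : Fin K) :
    evNorm (a i - sMean a) ^ 2 ≤ K * spNorm (sCov a a) := by
  set v := a i - sMean a with hv
  have hK : (0 : ℝ) < K := by exact_mod_cast i.pos
  have h1 : (K : ℝ)⁻¹ * (evNorm v ^ 2) ^ 2 ≤ v ⬝ᵥ (sCov a a).mulVec v := by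
    rw [sCov_quad]
    gcongr
    rw [← evNorm_sq']
    exact Finset.single_le_sum (f := fun i => ((a i - sMean a) ⬝ᵥ v) ^ 2)
      (fun j _ => sq_nonneg _) (Finset.mem_univ i)
  have h2 := (le_abs_self _).trans (abs_dot_le v ((sCov a a).mulVec v))
  have h3 := mulVec_le_spNorm (sCov a a) v
  have h0 := evNorm_nonneg' v
  have hS := spNorm_nonneg' (sCov a a)
  have h4 : (K : ℝ)⁻¹ * (evNorm v ^ 2) ^ 2 ≤ spNorm (sCov a a) * evNorm v ^ 2 := by nlinarith
  rw [inv_mul_le_iff₀ hK] at h4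
  rcases h0.eq_or_lt with h | h
  · rw [← h]; simp; positivity
  · have : 0 < evNorm v ^ 2 := by positivity
    nlinarith

lemma le_jac_aug {du dy : ℕ} (G : (Fin du → ℝ) → Fin dy → ℝ) (hreg : ContDiff ℝ 2 (aug G))
    (x w : Fin du → ℝ) : evNorm w ≤ evNorm ((jac (aug G) x).mulVec w) := by
  have hd : DifferentiableAt ℝ (aug G) x := (hreg.differentiable (by norm_num)) x
  have h1 : ∀ j : Fin du, ∀ v, fderiv ℝ (aug G) x v (Fin.natAdd dy j) = v j := by
    intro j v
    have h := (hasFDerivAt_pi'.1 hd.hasFDerivAt) (Fin.natAdd dy j)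
    have h2 : HasFDerivAt (fun y => aug G y (Fin.natAdd dy j))
        (ContinuousLinearMap.proj (R := ℝ) (φ := fun _ : Fin du => ℝ) j) x := by
      have : (fun y : Fin du → ℝ => aug G y (Fin.natAdd dy j)) = fun y => y j := by
        funext y; simp [aug]
      rw [this]
      exact hasFDerivAt_apply j x
    have := congrArg (fun T => T v) (h.unique h2)
    simpa using this
  have h2 : ∀ j : Fin du, (jac (aug G) x).mulVec w (Fin.natAdd dy j) = w j := by
    intro j
    simp only [jac, Matrix.mulVec, dotProduct, Matrix.of_apply, h1]
    simp [Pi.single_apply]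
  unfold evNorm
  apply Real.sqrt_le_sqrt
  rw [Fin.sum_univ_add]
  simp only [h2]
  have : 0 ≤ ∑ i : Fin dy, (jac (aug G) x).mulVec w (Fin.castAdd du i) ^ 2 :=
    Finset.sum_nonneg fun i _ => sq_nonneg _
  linarith

lemma sCov_quad_nonneg {K p : ℕ} (a : Fin K → Fin p → ℝ) (x : Fin p → ℝ) :
    0 ≤ x ⬝ᵥ (sCov a a).mulVec x := by
  rw [sCov_quad]
  exact mul_nonneg (by positivity) (Finset.sum_nonneg fun i _ => sq_nonneg _)

lemma coercive_add {d : ℕ} (P Γp : Matrix (Fin d) (Fin d) ℝ) (l c : ℝ) (hc : 0 < c)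
    (hP : ∀ v, 0 ≤ v ⬝ᵥ P.mulVec v)
    (hl : ∀ v, l * evNorm v ^ 2 ≤ v ⬝ᵥ Γp.mulVec v) (v : Fin d → ℝ) :
    (c * l) * evNorm v ^ 2 ≤ v ⬝ᵥ (P + c • Γp).mulVec v := by
  rw [Matrix.add_mulVec, Matrix.smul_mulVec, dotProduct_add, dotProduct_smul, smul_eq_mul]
  have := mul_le_mul_of_nonneg_left (hl v) hc.le
  have := hP v
  linarith

lemma mulVec_inv_bound {d : ℕ} (A : Matrix (Fin d) (Fin d) ℝ) (c : ℝ) (hc : 0 < c)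
    (h : ∀ v, c * evNorm v ^ 2 ≤ v ⬝ᵥ A.mulVec v) (r : Fin d → ℝ) :
    A.mulVec (A⁻¹.mulVec r) = r ∧ evNorm (A⁻¹.mulVec r) ≤ evNorm r / c := by
  have hu := inv_of_coercive A c hc h
  have h1 : A.mulVec (A⁻¹.mulVec r) = r := by
    rw [Matrix.mulVec_mulVec, Matrix.mul_nonsing_inv _ ((Matrix.isUnit_iff_isUnit_det A).1 hu),
      Matrix.one_mulVec]
  refine ⟨h1, coercive_norm hc (evNorm_nonneg' _) (evNorm_nonneg' _) ?_⟩
  refine (h _).trans ?_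
  rw [h1]
  exact (le_abs_self _).trans (abs_dot_le _ _)

lemma jcj_quad {K p q : ℕ} (a : Fin K → Fin p → ℝ) (J : Matrix (Fin q) (Fin p) ℝ)
    (x : Fin q → ℝ) :
    x ⬝ᵥ (J * sCov a a * Jᵀ).mulVec x = (Jᵀ.mulVec x) ⬝ᵥ (sCov a a).mulVec (Jᵀ.mulVec x) := by
  rw [← Matrix.mulVec_mulVec, ← Matrix.mulVec_mulVec, Matrix.dotProduct_mulVec,
    ← Matrix.mulVec_transpose]

/-- The Gauss–Newton gain is bounded uniformly in the step size and the covariance. -/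
lemma gain_bound {K p q : ℕ} (a : Fin K → Fin p → ℝ) (J : Matrix (Fin q) (Fin p) ℝ)
    (Γp : Matrix (Fin q) (Fin q) ℝ) (l L c : ℝ) (hl0 : 0 < l) (hL0 : 0 ≤ L) (hc : 0 < c)
    (hl : ∀ v, l * evNorm v ^ 2 ≤ v ⬝ᵥ Γp.mulVec v)
    (hL : ∀ v, evNorm (Γp.mulVec v) ≤ L * evNorm v)
    (hJ : ∀ w, evNorm w ≤ evNorm (J.mulVec w)) (r : Fin q → ℝ) :
    evNorm ((sCov a a * Jᵀ * (J * sCov a a * Jᵀ + c • Γp)⁻¹).mulVec r)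
      ≤ (1 + L / l) * evNorm r := by
  have hcoer := coercive_add (J * sCov a a * Jᵀ) Γp l c hc
    (fun v => by rw [jcj_quad]; exact sCov_quad_nonneg _ _) hl
  obtain ⟨hx, hxn⟩ := mulVec_inv_bound _ (c * l) (by positivity) hcoer r
  rw [← Matrix.mulVec_mulVec]
  set x := (J * sCov a a * Jᵀ + c • Γp)⁻¹.mulVec r
  refine (hJ _).trans ?_
  have h1 : J.mulVec ((sCov a a * Jᵀ).mulVec x) = r - c • Γp.mulVec x := by
    rw [← hx, Matrix.add_mulVec, Matrix.smul_mulVec, Matrix.mulVec_mulVec, ← Matrix.mul_assoc]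
    simp
  rw [h1]
  refine (evNorm_sub_le' _ _).trans ?_
  rw [evNorm_smul', abs_of_pos hc]
  calc evNorm r + c * evNorm (Γp.mulVec x) ≤ evNorm r + c * (L * (evNorm r / (c * l))) := by
        gcongr
        exact (hL x).trans (by gcongr)
    _ = _ := by field_simp

lemma rpow_id {k S : ℝ} (hk : 0 ≤ k) (hS : 0 ≤ S) :
    Real.sqrt (k * S) ^ 3 = Real.sqrt k * k * S ^ ((3 : ℝ) / 2) := by
  have h : S ^ ((3 : ℝ) / 2) = Real.sqrt S ^ 3 := by
    rw [Real.sqrt_eq_rpow, ← Real.rpow_natCast, ← Real.rpow_mul hS]; norm_num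
  rw [h, Real.sqrt_mul hk, mul_pow]
  have : Real.sqrt k ^ 3 = Real.sqrt k * k := by
    rw [pow_succ, Real.sq_sqrt hk]; ring
  rw [this]

/-- Proposition: EKI mean increment approximates the Gauss–Newton increment.
Under the Tikhonov EKI setup with the regularity assumption on `H = aug G`, there are a
constant `M₃ > 0` and a threshold `n₀` such that for all `n ≥ n₀`,
`‖Gₙ − Δₙ‖ ≤ M₃ hₙ K ‖Cₙᵘᵘ‖^(3/2) ‖z − H(mₙ)‖`. -/
theorem eki_gauss_newton_approx
    {du dy K : ℕ}
    (G : (Fin du → ℝ) → Fin dy → ℝ)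
    (M₁ M₂ : ℝ) (hM₁ : 0 < M₁) (hM₂ : 0 < M₂)
    (hreg : ContDiff ℝ 2 (aug G))
    (hJ : ∀ x, spNorm (jac (aug G) x) ≤ M₁)
    (hLip : ∀ x x', evNorm (aug G x - aug G x') ≤ M₁ * evNorm (x - x'))
    (hTay : ∀ x x',
      evNorm (aug G x' - aug G x - (jac (aug G) x).mulVec (x' - x)) ≤ M₂ * evNorm (x' - x) ^ 2)
    (Γ : Matrix (Fin dy) (Fin dy) ℝ) (hΓ : Γ.PosDef)
    (z : Fin (dy + du) → ℝ)
    (h₀ α₀ γ β : ℝ) (hh₀ : 0 < h₀) (hα₀ : 0 < α₀)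
    (hγ0 : 0 ≤ γ) (hγ1 : γ ≤ 1) (hβl : γ - 1 ≤ β) (hβu : β ≤ γ)
    (u : ℕ → Fin K → Fin du → ℝ)
    (hC1 : (Cuu (u 1)).PosDef)
    (hmean : ∀ n : ℕ, 1 ≤ n →
      sMean (u (n + 1)) = sMean (u n) +
        (Cup G (u n) *
          (Cpp G (u n) + (h₀ * (n : ℝ) ^ β)⁻¹ • gammaPlus Γ)⁻¹).mulVec
            (z - aug G (sMean (u n))))
    (hcov : ∀ n : ℕ, 1 ≤ n →
      Cuu (u (n + 1)) = Cuu (u n) -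
        Cup G (u n) * (Cpp G (u n) + (h₀ * (n : ℝ) ^ β)⁻¹ • gammaPlus Γ)⁻¹ * (Cup G (u n))ᵀ +
        (α₀ ^ 2 * h₀⁻¹ * (n : ℝ) ^ (2 * γ - β - 2)) • 1) :
    ∃ M₃ : ℝ, 0 < M₃ ∧ ∃ n₀ : ℕ, ∀ n : ℕ, n₀ ≤ n →
      evNorm
        ((Cuu (u n) * (jac (aug G) (sMean (u n)))ᵀ *
            (jac (aug G) (sMean (u n)) * Cuu (u n) * (jac (aug G) (sMean (u n)))ᵀ +
              (h₀ * (n : ℝ) ^ β)⁻¹ • gammaPlus Γ)⁻¹).mulVec (z - aug G (sMean (u n))) -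
         (Cup G (u n) *
            (Cpp G (u n) + (h₀ * (n : ℝ) ^ β)⁻¹ • gammaPlus Γ)⁻¹).mulVec
              (z - aug G (sMean (u n)))) ≤
      M₃ * (h₀ * (n : ℝ) ^ β) * K * spNorm (Cuu (u n)) ^ ((3 : ℝ) / 2) *
        evNorm (z - aug G (sMean (u n))) := by
  obtain ⟨l, hl0, hl⟩ := coercive_of_pos _ (gammaPlus_pos (du := du) Γ hΓ)
  obtain ⟨L, hL0, hL⟩ := exists_mulVec_bound (gammaPlus (du := du) Γ)
  refine ⟨(2 * M₂ + (1 + L / l) * (6 * M₁ * M₂)) / l * (Real.sqrt K + 1), by positivity, 1, ?_⟩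
  intro n hn
  have hn' : (0 : ℝ) < n := by exact_mod_cast hn
  have hh : 0 < h₀ * (n : ℝ) ^ β := by positivity
  set h := h₀ * (n : ℝ) ^ β
  set r := z - aug G (sMean (u n))
  clear_value h r
  clear hcov hmean
  set v := u n
  clear_value v
  set m := sMean v with hm
  set J := jac (aug G) m with hJdef
  have hc : 0 < h⁻¹ := by positivity
  set S := spNorm (Cuu v) with hSdef
  have hS : 0 ≤ S := spNorm_nonneg' _
  set R := Real.sqrt (K * S) with hR
  have hR0 : 0 ≤ R := Real.sqrt_nonneg _
  -- deviations
  have ha : ∀ i, evNorm (v i - m) ≤ R := fun i =>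
    Real.le_sqrt_of_sq_le (dev_sq_le v i)
  set e : Fin K → Fin (dy + du) → ℝ := fun i => aug G (v i) - sMean (fun i => aug G (v i)) with he
  set f : Fin K → Fin (dy + du) → ℝ := fun i => J.mulVec (v i - m) with hf
  have hJm : ∀ w, evNorm (J.mulVec w) ≤ M₁ * evNorm w := fun w =>
    (mulVec_le_spNorm J w).trans (mul_le_mul_of_nonneg_right (hJ m) (evNorm_nonneg' w))
  have hfn : ∀ i, evNorm (f i) ≤ M₁ * R := fun i =>
    (hJm _).trans (by gcongr; exact ha i)
  have ht : ∀ i, evNorm (aug G (v i) - aug G m - f i) ≤ M₂ * R ^ 2 := fun i =>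
    (hTay m (v i)).trans (by
      have := ha i
      have := evNorm_nonneg' (v i - m)
      gcongr)
  have hg : ∀ i, evNorm (aug G (v i) - aug G m) ≤ M₁ * R := fun i =>
    (hLip (v i) m).trans (by gcongr; exact ha i)
  have hsumf : ∑ i, f i = 0 := by
    simp only [hf]
    rw [← Matrix.mulVec_sum, sum_dev, Matrix.mulVec_zero]
  have hmeanH : ∀ _i : Fin K, sMean (fun i => aug G (v i)) - aug G m =
      (K : ℝ)⁻¹ • ∑ i, (aug G (v i) - aug G m) := by
    intro i0
    have : (K : ℝ) ≠ 0 := by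
      have := i0.pos
      positivity
    rw [Finset.sum_sub_distrib, Finset.sum_const, sMean, Finset.card_univ, Fintype.card_fin,
      ← Nat.cast_smul_eq_nsmul ℝ, smul_sub, smul_smul, inv_mul_cancel₀ this, one_smul]
  have hb1 : ∀ _i : Fin K, evNorm (sMean (fun i => aug G (v i)) - aug G m) ≤ M₁ * R := by
    intro i0
    rw [hmeanH i0]
    exact evNorm_avg_le _ _ (by positivity) hg
  have hb2 : ∀ _i : Fin K, evNorm (sMean (fun i => aug G (v i)) - aug G m) ≤ M₂ * R ^ 2 := by
    intro i0
    have : ∑ i, (aug G (v i) - aug G m) = ∑ i, (aug G (v i) - aug G m - f i) := by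
      rw [Finset.sum_sub_distrib (g := f), hsumf, sub_zero]
    rw [hmeanH i0, this]
    exact evNorm_avg_le _ _ (by positivity) ht
  have hen : ∀ i, evNorm (e i) ≤ 2 * M₁ * R := by
    intro i
    have : e i = (aug G (v i) - aug G m) - (sMean (fun i => aug G (v i)) - aug G m) := by
      simp [he]
    rw [this]
    have := evNorm_sub_le' (aug G (v i) - aug G m) (sMean (fun i => aug G (v i)) - aug G m)
    have := hg i
    have := hb1 i
    linarith
  have hrho : ∀ i, evNorm (e i - f i) ≤ 2 * M₂ * R ^ 2 := by
    intro i
    have : e i - f i = (aug G (v i) - aug G m - f i) -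
        (sMean (fun i => aug G (v i)) - aug G m) := by
      simp only [he]; abel
    rw [this]
    have := evNorm_sub_le' (aug G (v i) - aug G m - f i) (sMean (fun i => aug G (v i)) - aug G m)
    have := ht i
    have := hb2 i
    linarith
  -- covariance action
  have hJT : ∀ x i, (v i - m) ⬝ᵥ Jᵀ.mulVec x = f i ⬝ᵥ x := by
    intro x i
    rw [Matrix.dotProduct_mulVec, Matrix.vecMul_transpose]
  have hCJ : ∀ x, (Cuu v * Jᵀ).mulVec x = (K : ℝ)⁻¹ • ∑ i, (f i ⬝ᵥ x) • (v i - m) := by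
    intro x
    rw [← Matrix.mulVec_mulVec, Cuu, sCov_mulVec]
    simp only [← hm, hJT]
  have hP : ∀ x, (Cup G v).mulVec x = (K : ℝ)⁻¹ • ∑ i, (e i ⬝ᵥ x) • (v i - m) := by
    intro x
    rw [Cup, sCov_mulVec]
  have hQ : ∀ x, (Cpp G v).mulVec x = (K : ℝ)⁻¹ • ∑ i, (e i ⬝ᵥ x) • e i := by
    intro x
    rw [Cpp, sCov_mulVec]
  have hJCJ : ∀ x, (J * Cuu v * Jᵀ).mulVec x = (K : ℝ)⁻¹ • ∑ i, (f i ⬝ᵥ x) • f i := by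
    intro x
    rw [Matrix.mul_assoc, ← Matrix.mulVec_mulVec, hCJ, Matrix.mulVec_smul, Matrix.mulVec_sum]
    simp only [Matrix.mulVec_smul, hf]
  clear_value e f
  have hdot : ∀ (x y : Fin (dy + du) → ℝ) (c : ℝ), evNorm x ≤ c →
      |x ⬝ᵥ y| ≤ c * evNorm y := fun x y c hx =>
    (abs_dot_le x y).trans (mul_le_mul_of_nonneg_right hx (evNorm_nonneg' y))
  have hD1 : ∀ x, evNorm ((Cuu v * Jᵀ).mulVec x - (Cup G v).mulVec x) ≤
      2 * M₂ * R ^ 3 * evNorm x := by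
    intro x
    have hx := evNorm_nonneg' x
    rw [hCJ, hP, ← smul_sub, ← Finset.sum_sub_distrib]
    refine evNorm_avg_le _ _ (by positivity) fun i => ?_
    have : (f i ⬝ᵥ x) • (v i - m) - (e i ⬝ᵥ x) • (v i - m)
        = (-((e i - f i) ⬝ᵥ x)) • (v i - m) := by
      rw [sub_dotProduct, ← sub_smul, neg_sub]
    rw [this, evNorm_smul', abs_neg]
    calc _ ≤ (2 * M₂ * R ^ 2 * evNorm x) * R :=
          mul_le_mul (hdot _ _ _ (hrho i)) (ha i) (evNorm_nonneg' _) (by positivity)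
      _ = _ := by ring
  have hD2 : ∀ x, evNorm ((Cpp G v).mulVec x - (J * Cuu v * Jᵀ).mulVec x) ≤
      6 * M₁ * M₂ * R ^ 3 * evNorm x := by
    intro x
    have hx := evNorm_nonneg' x
    rw [hJCJ, hQ, ← smul_sub, ← Finset.sum_sub_distrib]
    refine evNorm_avg_le _ _ (by positivity) fun i => ?_
    have : (e i ⬝ᵥ x) • e i - (f i ⬝ᵥ x) • f i
        = (e i ⬝ᵥ x) • (e i - f i) + ((e i - f i) ⬝ᵥ x) • f i := by
      rw [sub_dotProduct, sub_smul, smul_sub]; abel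
    rw [this]
    refine (evNorm_add_le' _ _).trans ?_
    rw [evNorm_smul', evNorm_smul']
    calc _ ≤ (2 * M₁ * R * evNorm x) * (2 * M₂ * R ^ 2)
          + (2 * M₂ * R ^ 2 * evNorm x) * (M₁ * R) :=
          add_le_add
            (mul_le_mul (hdot _ _ _ (hen i)) (hrho i) (evNorm_nonneg' _) (by positivity))
            (mul_le_mul (hdot _ _ _ (hrho i)) (hfn i) (evNorm_nonneg' _) (by positivity))
      _ = _ := by ring
  -- inverses
  have hcA := coercive_add (J * Cuu v * Jᵀ) (gammaPlus Γ) l h⁻¹ hc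
    (fun v => by rw [Cuu, jcj_quad]; exact sCov_quad_nonneg _ _) hl
  have hcB := coercive_add (Cpp G v) (gammaPlus Γ) l h⁻¹ hc
    (fun v => by rw [Cpp]; exact sCov_quad_nonneg _ _) hl
  have hgain := gain_bound v J (gammaPlus Γ) l L h⁻¹ hl0 hL0 hc hl hL (le_jac_aug G hreg m)
  obtain ⟨hBx, hBn⟩ := mulVec_inv_bound _ _ (by positivity) hcB r
  have hAu := inv_of_coercive _ _ (by positivity) hcA
  rw [← Matrix.mulVec_mulVec r (Cup G v)]
  change ∀ r, evNorm ((Cuu v * Jᵀ * (J * Cuu v * Jᵀ + h⁻¹ • gammaPlus Γ)⁻¹).mulVec r) ≤ _ at hgain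
  set A := J * Cuu v * Jᵀ + h⁻¹ • gammaPlus Γ with hA
  set B := Cpp G v + h⁻¹ • gammaPlus Γ with hB
  set x := B⁻¹.mulVec r with hxdef
  have hBA : r = A.mulVec x + ((Cpp G v).mulVec x - (J * Cuu v * Jᵀ).mulVec x) := by
    rw [← hBx, hA, hB, Matrix.add_mulVec, Matrix.add_mulVec]; abel
  have hsplit : (Cuu v * Jᵀ * A⁻¹).mulVec r = (Cuu v * Jᵀ).mulVec x +
      (Cuu v * Jᵀ * A⁻¹).mulVec ((Cpp G v).mulVec x - (J * Cuu v * Jᵀ).mulVec x) := by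
    conv_lhs => rw [hBA]
    rw [Matrix.mulVec_add, Matrix.mulVec_mulVec, Matrix.mul_assoc,
      Matrix.nonsing_inv_mul _ ((Matrix.isUnit_iff_isUnit_det A).1 hAu), Matrix.mul_one]
  rw [hsplit, add_sub_right_comm]
  refine (evNorm_add_le' _ _).trans ?_
  have hrn := evNorm_nonneg' r
  have hR3 : R ^ 3 = Real.sqrt K * K * S ^ ((3 : ℝ) / 2) := rpow_id (by positivity) hS
  have hSp : 0 ≤ S ^ ((3 : ℝ) / 2) := by positivity
  calc _ ≤ 2 * M₂ * R ^ 3 * evNorm x + (1 + L / l) * (6 * M₁ * M₂ * R ^ 3 * evNorm x) := by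
        refine add_le_add (hD1 x) ((hgain _).trans ?_)
        gcongr
        exact hD2 x
    _ = (2 * M₂ + (1 + L / l) * (6 * M₁ * M₂)) * R ^ 3 * evNorm x := by ring
    _ ≤ (2 * M₂ + (1 + L / l) * (6 * M₁ * M₂)) * R ^ 3 * (evNorm r / (h⁻¹ * l)) := by gcongr
    _ = (2 * M₂ + (1 + L / l) * (6 * M₁ * M₂)) / l * Real.sqrt K * h * K *
          S ^ ((3 : ℝ) / 2) * evNorm r := by
        rw [hR3]; field_simp
    _ ≤ _ := by
        gcongr
        linarith
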